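/- arXiv:1311.1226 — 2 statements merged into one kernel-verified Lean document; each statement's English description precedes it below -/
import Mathlib

section
/- Assume hypotheses (R1) and (L1). Then for all j,k ∈ {1,…,n−1} and for every first-order Wirtinger direction ∂_A ∈ {∂/∂z_1,…,∂/∂z_n, ∂/∂z̄_1,…,∂/∂z̄_n}, one has u_{jk̄A} = ∂_A(u_{jk̄}) = 0 at every point of L. -/
open Complex
open scoped ComplexOrder

/-- Wirtinger derivative in direction `d.1`; `d.2 = true` means `∂/∂z̄`, `false` means `∂/∂z`. -/
noncomputable def wd {n : ℕ} (d : Fin n × Bool) (f : (Fin n → ℂ) → ℂ) : (Fin n → ℂ) → ℂ :=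
  fun z => (1/2 : ℂ) * (fderiv ℝ f z (Pi.single d.1 1) +
      (if d.2 then Complex.I else -Complex.I) * fderiv ℝ f z (Pi.single d.1 Complex.I))

/-- Iterated Wirtinger derivative: differentiate in the listed directions, left to right. -/
noncomputable def wderiv {n : ℕ} (l : List (Fin n × Bool)) (f : (Fin n → ℂ) → ℂ) :
    (Fin n → ℂ) → ℂ :=
  l.foldl (fun g d => wd d g) f

/-- The real function `u` viewed as a complex-valued function. -/
def cplx {n : ℕ} (u : (Fin n → ℂ) → ℝ) : (Fin n → ℂ) → ℂ := fun z => (u z : ℂ)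

/-- Levi matrix entry `u_{jk̄} = ∂²u/∂z_j∂z̄_k`. -/
noncomputable def levi {n : ℕ} (u : (Fin n → ℂ) → ℝ) (j k : Fin n) : (Fin n → ℂ) → ℂ :=
  wderiv [(j, false), (k, true)] (cplx u)

theorem wd_smooth {n : ℕ} {U : Set (Fin n → ℂ)} (hU : IsOpen U) (d : Fin n × Bool)
    {f : (Fin n → ℂ) → ℂ} (hf : ContDiffOn ℝ (⊤ : ℕ∞) f U) :
    ContDiffOn ℝ (⊤ : ℕ∞) (wd d f) U := by
  have h : ContDiffOn ℝ (⊤ : ℕ∞) (fderiv ℝ f) U :=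
    hf.fderiv_of_isOpen hU (by simp)
  unfold wd
  exact contDiffOn_const.mul ((h.clm_apply contDiffOn_const).add
    (contDiffOn_const.mul (h.clm_apply contDiffOn_const)))

theorem levi_diff {n : ℕ} {U : Set (Fin n → ℂ)} (hU : IsOpen U)
    {u : (Fin n → ℂ) → ℝ} (hu : ContDiffOn ℝ (⊤ : ℕ∞) u U) (j k : Fin n)
    {z : Fin n → ℂ} (hz : z ∈ U) : DifferentiableAt ℝ (levi u j k) z := by
  have h0 : ContDiffOn ℝ (⊤ : ℕ∞) (cplx u) U :=
    Complex.ofRealCLM.contDiff.comp_contDiffOn hu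
  have h : ContDiffOn ℝ (⊤ : ℕ∞) (levi u j k) U := wd_smooth hU _ (wd_smooth hU _ h0)
  exact (h.contDiffAt (hU.mem_nhds hz)).differentiableAt (by simp)

/-- under (R1) and (L1), all third derivatives u_{jk̄A} of the tangential
Levi entries vanish along the leaf L = {z_n = 0}. -/
theorem stmt_3 {m : ℕ} (hm : 1 ≤ m) (U : Set (Fin (m+1) → ℂ)) (hU : IsOpen U)
    (u : (Fin (m+1) → ℂ) → ℝ) (hsmooth : ContDiffOn ℝ (⊤ : ℕ∞) u U)
    (hR1 : ∀ z ∈ U, ∀ j k : Fin (m+1), j ≠ Fin.last m → k ≠ Fin.last m →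
      levi u j k z * levi u (Fin.last m) (Fin.last m) z
        - levi u j (Fin.last m) z * levi u (Fin.last m) k z = 0)
    (hL1 : ∀ z ∈ U, z (Fin.last m) = 0 →
      (∀ j k : Fin (m+1), (j, k) ≠ (Fin.last m, Fin.last m) → levi u j k z = 0) ∧
      0 < (levi u (Fin.last m) (Fin.last m) z).re ∧
      (levi u (Fin.last m) (Fin.last m) z).im = 0) :
    ∀ z ∈ U, z (Fin.last m) = 0 →
      ∀ j k : Fin (m+1), j ≠ Fin.last m → k ≠ Fin.last m →
      ∀ A : Fin (m+1) × Bool,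
        wderiv [(j, false), (k, true), A] (cplx u) z = 0 := by
  intro z hz hzl j k hj hk A
  obtain ⟨h0, hpos, -⟩ := hL1 z hz hzl
  have hb : levi u (Fin.last m) (Fin.last m) z ≠ 0 := by
    intro h
    simp [h] at hpos
  have ha : levi u j k z = 0 := h0 j k (by simp [hj])
  have hc : levi u j (Fin.last m) z = 0 := h0 _ _ (by simp [hj])
  have hd : levi u (Fin.last m) k z = 0 := h0 _ _ (by simp [hk])
  have D := fun j k => (levi_diff hU hsmooth j k hz).hasFDerivAt
  have H := ((D j k).mul (D (Fin.last m) (Fin.last m))).sub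
    ((D j (Fin.last m)).mul (D (Fin.last m) k))
  have Z : HasFDerivAt (levi u j k * levi u (Fin.last m) (Fin.last m)
      - levi u j (Fin.last m) * levi u (Fin.last m) k)
      (0 : (Fin (m+1) → ℂ) →L[ℝ] ℂ) z := by
    refine (hasFDerivAt_const (0 : ℂ) z).congr_of_eventuallyEq ?_
    filter_upwards [hU.mem_nhds hz] with w hw
    exact hR1 w hw j k hj hk
  have E := H.unique Z
  rw [ha, hc, hd] at E
  have F : fderiv ℝ (levi u j k) z = 0 := by
    ext1 v
    have := congrArg (fun L : (Fin (m+1) → ℂ) →L[ℝ] ℂ => L v) E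
    simpa [hb] using this
  change wd A (levi u j k) z = 0
  simp [wd, F]
end

section
/- Let h : ℂ → ℝ be a C² function with h ≥ 0 everywhere, such that at every point where h > 0 one has ∂²(log h)/∂z∂z̄ ≥ 2h. Then h ≡ 0 on ℂ. (This is the step showing that a pseudometric of curvature ≤ −4 on a parabolic Riemann surface covered by ℂ must vanish identically, which forces the Bedford–Burns twist tensor of a parabolic Monge–Ampère foliation to vanish.) -/
open Complex

/-- One-variable Wirtinger derivative; `bar = true` means `∂/∂z̄`, `false` means `∂/∂z`. -/
noncomputable def wd1 (bar : Bool) (f : ℂ → ℂ) : ℂ → ℂ :=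
  fun z => (1/2 : ℂ) * (fderiv ℝ f z 1 +
    (if bar then Complex.I else -Complex.I) * fderiv ℝ f z Complex.I)

open Filter Topology

/-- At a local maximum the second derivative is nonpositive. -/
lemma second_deriv_nonpos {g g' : ℝ → ℝ} {c : ℝ} (hm : IsLocalMax g 0)
    (h1 : ∀ᶠ t in 𝓝 (0:ℝ), HasDerivAt g (g' t) t) (h2 : HasDerivAt g' c 0) : c ≤ 0 := by
  by_contra! hc
  have hd : deriv g =ᶠ[𝓝 0] g' := h1.mono fun t ht => ht.deriv
  have hdd : deriv (deriv g) 0 = c := by rw [hd.deriv_eq, h2.deriv]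
  have hmin : IsLocalMin g 0 := isLocalMin_of_deriv_deriv_pos (by rw [hdd]; exact hc)
    hm.deriv_eq_zero h1.self_of_nhds.continuousAt
  have hconst : g =ᶠ[𝓝 0] fun _ => g 0 := by
    filter_upwards [hm, hmin] with t h1 h2 using le_antisymm h1 h2
  have h3 : deriv (deriv g) 0 = 0 := by
    rw [hconst.deriv.deriv_eq]; simp
  linarith

lemma line_bound {u : ℂ → ℝ} {p v : ℂ} {b c : ℝ} (hu : ContDiffAt ℝ 2 u p) (hc : 0 < c)
    (hm : IsLocalMax (fun t : ℝ => u (p + t * v) + 2 * Real.log (c - b * t - t ^ 2)) 0) :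
    fderiv ℝ (fun w => fderiv ℝ u w v) p v ≤ 2 * (2 * c + b ^ 2) / c ^ 2 := by
  have hline : ∀ t : ℝ, HasDerivAt (fun t : ℝ => p + t * v) v t := by
    intro t
    simpa using ((Complex.ofRealCLM.hasDerivAt (x := t)).mul_const v).const_add p
  have hcont : Tendsto (fun t : ℝ => p + t * v) (𝓝 0) (𝓝 p) := by
    have := (hline 0).continuousAt.tendsto
    simpa using this
  have hq : ∀ t : ℝ, HasDerivAt (fun t : ℝ => c - b * t - t ^ 2) (-b - 2 * t) t := by
    intro t
    have := (((hasDerivAt_id t).const_mul b).const_sub c).sub ((hasDerivAt_id t).pow 2)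
    exact this.congr_deriv (by simp)
  have hpos : ∀ᶠ t in 𝓝 (0:ℝ), 0 < c - b * t - t ^ 2 := by
    have := (hq 0).continuousAt
    exact this.eventually (lt_mem_nhds (by simpa using hc))
  have hdiff : ∀ᶠ w in 𝓝 p, DifferentiableAt ℝ u w :=
    (hu.eventually (by simp)).mono fun w hw => hw.differentiableAt (by simp)
  have hfd : DifferentiableAt ℝ (fun w => fderiv ℝ u w v) p := by
    have h1 : ContDiffAt ℝ 1 (fderiv ℝ u) p := hu.fderiv_right (by norm_num)
    exact (h1.differentiableAt (by simp)).clm_apply (differentiableAt_const v)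
  have key := second_deriv_nonpos (g' := fun t : ℝ => fderiv ℝ u (p + t * v) v
      + 2 * ((-b - 2 * t) / (c - b * t - t ^ 2)))
      (c := fderiv ℝ (fun w => fderiv ℝ u w v) p v - 2 * (2 * c + b ^ 2) / c ^ 2) hm ?_ ?_
  · linarith
  · filter_upwards [hpos, hcont.eventually hdiff] with t h1 h2
    exact (h2.hasFDerivAt.comp_hasDerivAt t (hline t)).add
      (((hq t).log h1.ne').const_mul 2)
  · have e1 : HasDerivAt (fun t : ℝ => fderiv ℝ u (p + t * v) v)
        (fderiv ℝ (fun w => fderiv ℝ u w v) p v) 0 := by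
      have h0 : HasFDerivAt (fun w => fderiv ℝ u w v) (fderiv ℝ (fun w => fderiv ℝ u w v) p)
          (p + ((0:ℝ):ℂ) * v) := by simpa using hfd.hasFDerivAt
      exact h0.comp_hasDerivAt (0:ℝ) (hline 0)
    have e2 : HasDerivAt (fun t : ℝ => -b - 2 * t) (-2) 0 := by
      simpa using ((hasDerivAt_id (0:ℝ)).const_mul 2).const_sub (-b)
    have e3 := (e2.div (hq 0) (by simpa using hc.ne')).const_mul 2
    refine (e1.add e3).congr_deriv ?_
    simp
    field_simp
    ring

lemma wd_log {u : ℂ → ℝ} {p : ℂ} (hu : ContDiffAt ℝ 2 u p) :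
    (wd1 true (wd1 false (fun w => (u w : ℂ))) p).re =
      (1/4) * (fderiv ℝ (fun w => fderiv ℝ u w 1) p 1
        + fderiv ℝ (fun w => fderiv ℝ u w I) p I) := by
  have hdiff : ∀ᶠ w in 𝓝 p, DifferentiableAt ℝ u w :=
    (hu.eventually (by simp)).mono fun w hw => hw.differentiableAt (by simp)
  have hfd : ∀ v : ℂ, DifferentiableAt ℝ (fun w => fderiv ℝ u w v) p := by
    intro v
    have h1 : ContDiffAt ℝ 1 (fderiv ℝ u) p := hu.fderiv_right (by norm_num)
    exact (h1.differentiableAt (by simp)).clm_apply (differentiableAt_const v)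
  have h1 : wd1 false (fun w => (u w : ℂ)) =ᶠ[𝓝 p] fun w =>
      (1/2 : ℂ) * (((fderiv ℝ u w 1 : ℝ) : ℂ) + (-I) * ((fderiv ℝ u w I : ℝ) : ℂ)) := by
    filter_upwards [hdiff] with w hw
    have : HasFDerivAt (fun w => (u w : ℂ)) (Complex.ofRealCLM.comp (fderiv ℝ u w)) w :=
      Complex.ofRealCLM.hasFDerivAt.comp w hw.hasFDerivAt
    simp [wd1, this.fderiv]
  have ho : ∀ v : ℂ, HasFDerivAt (fun w => ((fderiv ℝ u w v : ℝ) : ℂ))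
      (Complex.ofRealCLM.comp (fderiv ℝ (fun w => fderiv ℝ u w v) p)) p := fun v =>
    Complex.ofRealCLM.hasFDerivAt.comp p (hfd v).hasFDerivAt
  have h2 := ((ho 1).add ((ho I).const_mul (-I))).const_mul (1/2 : ℂ)
  have h3 : fderiv ℝ (wd1 false (fun w => (u w : ℂ))) p = _ := h1.fderiv_eq.trans h2.fderiv
  rw [wd1, h3]
  simp
  ring

/-- a nonnegative C² conformal density h on all of ℂ with
∂²(log h)/∂z∂z̄ ≥ 2h wherever h > 0 vanishes identically. -/
theorem stmt_11 (h : ℂ → ℝ) (hC2 : ContDiff ℝ 2 h)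
    (hnonneg : ∀ z : ℂ, 0 ≤ h z)
    (hcurv : ∀ z : ℂ, 0 < h z →
      2 * h z ≤ (wd1 true (wd1 false (fun w => (Real.log (h w) : ℂ))) z).re) :
    ∀ z : ℂ, h z = 0 := by
  intro z0
  by_contra hne
  have h0 : 0 < h z0 := lt_of_le_of_ne (hnonneg z0) (Ne.symm hne)
  have main : ∀ R : ℝ, 0 < R → h z0 * R ^ 2 ≤ 1 := by
    intro R hR
    set q : ℂ → ℝ := fun z => R ^ 2 - ((z - z0).re ^ 2 + (z - z0).im ^ 2) with hq
    have hqc : Continuous q := by rw [hq]; fun_prop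
    have hnorm : ∀ z, q z = R ^ 2 - ‖z - z0‖ ^ 2 := by
      intro z; rw [Complex.sq_norm, Complex.normSq_apply]; simp only [hq]; ring
    obtain ⟨p, hpB, hpmax⟩ := (isCompact_closedBall z0 R).exists_isMaxOn
      ⟨z0, Metric.mem_closedBall_self hR.le⟩
      (f := fun z => h z * q z ^ 2) ((hC2.continuous.mul (hqc.pow 2)).continuousOn)
    have hpz : h z0 * (R ^ 2) ^ 2 ≤ h p * q p ^ 2 := by
      have := hpmax (Metric.mem_closedBall_self hR.le)
      simpa [hq] using this
    have hpp : 0 < h p * q p ^ 2 := lt_of_lt_of_le (by positivity) hpz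
    have hqp0 : q p ≠ 0 := by
      intro hh; rw [hh] at hpp; simp at hpp
    have hhp : 0 < h p := lt_of_le_of_ne (hnonneg p) (by
      intro hh; rw [← hh] at hpp; simp at hpp)
    have hqp : 0 < q p := by
      refine lt_of_le_of_ne ?_ hqp0.symm
      rw [hnorm]
      have : ‖p - z0‖ ≤ R := by simpa [dist_eq_norm] using hpB
      have := norm_nonneg (p - z0)
      nlinarith
    have hu : ContDiffAt ℝ 2 (fun w => Real.log (h w)) p := hC2.contDiffAt.log hhp.ne'
    have hmaxlog : IsLocalMax (fun z => Real.log (h z) + 2 * Real.log (q z)) p := by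
      have a1 : ∀ᶠ z in 𝓝 p, 0 < q z := hqc.continuousAt.eventually (lt_mem_nhds hqp)
      have a2 : ∀ᶠ z in 𝓝 p, 0 < h z := hC2.continuous.continuousAt.eventually (lt_mem_nhds hhp)
      have e : ∀ z, 0 < q z → 0 < h z →
          Real.log (h z) + 2 * Real.log (q z) = Real.log (h z * q z ^ 2) := by
        intro z b1 b2
        rw [Real.log_mul b2.ne' (by positivity), Real.log_pow]; norm_num
      filter_upwards [a1, a2] with z b1 b2
      rw [e z b1 b2, e p hqp hhp]
      apply Real.log_le_log (by positivity)
      apply hpmax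
      rw [Metric.mem_closedBall, dist_eq_norm]
      rw [hnorm] at b1
      exact abs_le_of_sq_le_sq' (by linarith) hR.le |>.2
    have hcomp : ∀ v : ℂ, IsLocalMax
        (fun t : ℝ => Real.log (h (p + t * v)) + 2 * Real.log (q (p + t * v))) 0 := by
      intro v
      have hc : Tendsto (fun t : ℝ => p + t * v) (𝓝 0) (𝓝 p) := by
        have : Continuous (fun t : ℝ => p + t * v) := by fun_prop
        simpa using this.tendsto 0
      have := hc.eventually hmaxlog
      simpa [IsLocalMax, IsMaxFilter] using this
    have l1 := line_bound (v := 1) (b := 2 * (p - z0).re) (c := q p) hu hqp (by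
      convert hcomp 1 using 5
      simp [hq]; ring)
    have l2 := line_bound (v := I) (b := 2 * (p - z0).im) (c := q p) hu hqp (by
      convert hcomp I using 5
      simp [hq]; ring)
    have hk := hcurv p hhp
    rw [wd_log hu] at hk
    have hsum : 2 * (2 * q p + (2 * (p - z0).re) ^ 2) / q p ^ 2
        + 2 * (2 * q p + (2 * (p - z0).im) ^ 2) / q p ^ 2 = 8 * R ^ 2 / q p ^ 2 := by
      rw [← add_div]; congr 1; simp only [hq]; ring
    have hfin : h p ≤ R ^ 2 / q p ^ 2 := by
      have : 8 * R ^ 2 / q p ^ 2 = 8 * (R ^ 2 / q p ^ 2) := by ring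
      linarith
    rw [le_div_iff₀ (by positivity)] at hfin
    have : (h z0 * R ^ 2) * R ^ 2 ≤ 1 * R ^ 2 := by nlinarith
    exact le_of_mul_le_mul_right this (by positivity)
  have hR := main (1 + 1 / h z0) (by positivity)
  have e : h z0 * (1 + 1 / h z0) ^ 2 = h z0 + 2 + 1 / h z0 := by field_simp; ring
  have : 0 < 1 / h z0 := by positivity
  linarith
end
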